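/- For every n > 1, the basis permutations of length n having exactly n−1 non-left-to-right-maxima are exactly the permutations of the form n·α, i.e., those whose first value is n, where α is an arbitrary permutation of {1,…,n−1}. Consequently b_{n,n−2} = (n−1)!. -/

import Mathlib

/-- The word `σ₁σ₂…σₙ` of a permutation of `{1,…,n}` (0-indexed). -/
def permWord {n : ℕ} (σ : Equiv.Perm (Fin n)) : List (Fin n) :=
  List.ofFn (fun i => σ i)

/-- `β` is obtained from `α` by one right-jump: one entry is removed and
reinserted at a strictly later position. -/
def RightJump {n : ℕ} (α β : Equiv.Perm (Fin n)) : Prop :=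
  ∃ (l₁ l₂ l₃ : List (Fin n)) (a : Fin n), l₂ ≠ [] ∧
    permWord α = l₁ ++ a :: (l₂ ++ l₃) ∧
    permWord β = l₁ ++ (l₂ ++ a :: l₃)

/-- `ReachIn p α β` : `β` is obtained from `α` by a sequence of exactly `p` right-jumps. -/
def ReachIn {n : ℕ} : ℕ → Equiv.Perm (Fin n) → Equiv.Perm (Fin n) → Prop
  | 0, α, β => α = β
  | p + 1, α, β => ∃ γ, RightJump α γ ∧ ReachIn p γ β

/-- `σᵢ` is a left-to-right maximum of `σ`. -/
def IsLtrMax {n : ℕ} (σ : Equiv.Perm (Fin n)) (i : Fin n) : Prop :=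
  ∀ j, j ≤ i → σ j ≤ σ i

/-- The number of non-left-to-right-maxima of `σ`. -/
noncomputable def nonLtrMaxCount {n : ℕ} (σ : Equiv.Perm (Fin n)) : ℕ :=
  {i : Fin n | ¬ IsLtrMax σ i}.ncard

/-- `π` is a pattern of `σ` (`π ≺ σ`): `σ` has a subsequence order-isomorphic to `π`. -/
def IsPattern {k n : ℕ} (π : Equiv.Perm (Fin k)) (σ : Equiv.Perm (Fin n)) : Prop :=
  ∃ f : Fin k → Fin n, StrictMono f ∧ ∀ i j : Fin k, π i < π j ↔ σ (f i) < σ (f j)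

/-- `σ ∈ Cₚ` : `σ` is obtainable from the identity by at most `p` right-jumps. -/
def InC (p : ℕ) {n : ℕ} (σ : Equiv.Perm (Fin n)) : Prop :=
  ∃ q ≤ p, ReachIn q 1 σ

/-- `σ ∈ Bₚ`, the basis of `Cₚ`: `σ ∉ Cₚ` and every pattern `π ≺ σ` with `π ≠ σ`
(equivalently, of length `≠ n`) belongs to `Cₚ`. -/
def InBasis (p : ℕ) {n : ℕ} (σ : Equiv.Perm (Fin n)) : Prop :=
  ¬ InC p σ ∧ ∀ (k : ℕ) (π : Equiv.Perm (Fin k)), IsPattern π σ → k ≠ n → InC p π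

/-- `b_{n,p}`: the number of basis permutations of length `n` in `Bₚ`. -/
noncomputable def bnp (n p : ℕ) : ℕ :=
  Nat.card {σ : Equiv.Perm (Fin n) // InBasis p σ}

/-- `y` occurs before `x` in the list. -/
def bef {α : Type*} (y x : α) : List α → Prop
  | [] => False
  | a :: l => (y = a ∧ x ∈ l) ∨ bef y x l

theorem bef_append {α : Type*} (y x : α) (A B : List α) :
    bef y x (A ++ B) ↔ bef y x A ∨ (y ∈ A ∧ x ∈ B) ∨ bef y x B := by
  induction A with
  | nil => simp [bef]
  | cons a A ih => simp only [List.cons_append, bef, ih, List.mem_append, List.mem_cons]; tauto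

theorem bef_cons {α : Type*} (y x a : α) (l : List α) :
    bef y x (a :: l) ↔ (y = a ∧ x ∈ l) ∨ bef y x l := Iff.rfl

theorem bef_mem {α : Type*} (y x : α) (l : List α) (h : bef y x l) : y ∈ l ∧ x ∈ l := by
  induction l with
  | nil => exact h.elim
  | cons a A ih =>
    rcases h with h | h
    · simp [h.1, h.2]
    · simp [ih h]

theorem bef_ofFn {α : Type*} (y x : α) : ∀ {n : ℕ} (f : Fin n → α),
    bef y x (List.ofFn f) ↔ ∃ i j, i < j ∧ f i = y ∧ f j = x
  | 0, f => by simp [bef]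
  | n + 1, f => by
    rw [List.ofFn_succ, bef_cons, bef_ofFn y x (fun i => f i.succ)]
    simp only [Fin.exists_fin_succ, List.mem_ofFn]
    simp [Fin.succ_pos]
    grind

/-- values that are not left-to-right maxima -/
def NV {n : ℕ} (l : List (Fin n)) : Set (Fin n) := {x | ∃ y, x < y ∧ bef y x l}

theorem count_eq {n : ℕ} (σ : Equiv.Perm (Fin n)) :
    nonLtrMaxCount σ = (NV (permWord σ)).ncard := by
  have : NV (permWord σ) = σ '' {i : Fin n | ¬ IsLtrMax σ i} := by
    ext x
    simp only [NV, permWord, bef_ofFn, IsLtrMax, Set.mem_setOf_eq, Set.mem_image]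
    push Not
    constructor
    · rintro ⟨y, hxy, i, j, hij, rfl, rfl⟩
      exact ⟨j, ⟨i, hij.le, hxy⟩, rfl⟩
    · rintro ⟨j, ⟨i, hij, h⟩, rfl⟩
      exact ⟨_, h, i, j, lt_of_le_of_ne hij (by rintro rfl; exact lt_irrefl _ h), rfl, rfl⟩
  rw [this, Set.ncard_image_of_injective _ σ.injective]
  rfl

theorem jump_le {n : ℕ} {α β : Equiv.Perm (Fin n)} (h : RightJump α β) :
    nonLtrMaxCount β ≤ nonLtrMaxCount α + 1 := by
  obtain ⟨l₁, l₂, l₃, a, -, hα, hβ⟩ := h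
  rw [count_eq, count_eq, hα, hβ]
  refine le_trans (Set.ncard_le_ncard (t := insert a (NV (l₁ ++ a :: (l₂ ++ l₃)))) ?_
    (Set.toFinite _)) (Set.ncard_insert_le _ _)
  rintro x ⟨y, hxy, hb⟩
  by_cases hx : x = a
  · exact Or.inl hx
  · refine Or.inr ⟨y, hxy, ?_⟩
    simp only [bef_append, bef_cons, List.mem_append, List.mem_cons] at hb ⊢
    tauto

theorem reach_le {n : ℕ} : ∀ (q : ℕ) {α β : Equiv.Perm (Fin n)}, ReachIn q α β →
    nonLtrMaxCount β ≤ nonLtrMaxCount α + q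
  | 0, α, β, h => by
    have : α = β := h
    simp [this]
  | q + 1, α, β, h => by
    obtain ⟨γ, h1, h2⟩ := h
    have := jump_le h1
    have := reach_le q h2
    omega

theorem reach_snoc {n : ℕ} : ∀ (q : ℕ) {α β γ : Equiv.Perm (Fin n)}, ReachIn q α β →
    RightJump β γ → ReachIn (q + 1) α γ
  | 0, α, β, γ, h, h' => by
    have : α = β := h
    subst this
    exact ⟨γ, h', rfl⟩
  | q + 1, α, β, γ, h, h' => by
    obtain ⟨δ, h1, h2⟩ := h
    exact ⟨δ, h1, reach_snoc q h2 h'⟩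

theorem count_one (n : ℕ) : nonLtrMaxCount (1 : Equiv.Perm (Fin n)) = 0 := by
  have : {i : Fin n | ¬ IsLtrMax (1 : Equiv.Perm (Fin n)) i} = ∅ := by
    ext i; simp [IsLtrMax]
  rw [nonLtrMaxCount, this, Set.ncard_empty]

theorem eq_one_of_count {n : ℕ} (σ : Equiv.Perm (Fin n)) (h : nonLtrMaxCount σ = 0) :
    σ = 1 := by
  rw [nonLtrMaxCount, Set.ncard_eq_zero (Set.toFinite _)] at h
  have hm : StrictMono σ := by
    intro i j hij
    have hj : IsLtrMax σ j := by
      by_contra hc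
      have : j ∈ ({i : Fin n | ¬ IsLtrMax σ i} : Set _) := hc
      rw [h] at this
      exact this
    exact lt_of_le_of_ne (hj i hij.le) (fun e => hij.ne (σ.injective e))
  have hr : Set.range σ = Set.range (id : Fin n → Fin n) := by simp
  have := (StrictMono.range_inj hm strictMono_id).1 hr
  ext i
  rw [this]; rfl

theorem exists_perm {n : ℕ} (l : List (Fin n)) (σ : Equiv.Perm (Fin n))
    (h : l.Perm (permWord σ)) : ∃ γ : Equiv.Perm (Fin n), permWord γ = l := by
  have hn : l.Nodup := h.nodup_iff.2 (List.nodup_ofFn.2 σ.injective)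
  have hl : l.length = n := by rw [h.length_eq]; simp [permWord]
  have hinj : Function.Injective (fun i : Fin n => l.get (i.cast hl.symm)) := by
    intro i j hij
    have := List.nodup_iff_injective_get.1 hn hij
    simpa using this
  refine ⟨Equiv.ofBijective _ (Finite.injective_iff_bijective.1 hinj), ?_⟩
  apply List.ext_get
  · simp [permWord, hl]
  · intro i h1 h2
    simp [permWord]

theorem split_first {α : Type*} (P : α → Prop) : ∀ (l : List α), (∃ x ∈ l, P x) →
    ∃ l₁ b r, l = l₁ ++ b :: r ∧ P b ∧ ∀ x ∈ l₁, ¬ P x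
  | [], h => by simp at h
  | c :: l, h => by
    by_cases hc : P c
    · exact ⟨[], c, l, rfl, hc, by simp⟩
    · obtain ⟨l₁, b, r, h1, h2, h3⟩ := split_first P l (by
        obtain ⟨x, hx, hp⟩ := h
        rcases List.mem_cons.1 hx with rfl | hx
        · exact absurd hp hc
        · exact ⟨x, hx, hp⟩)
      refine ⟨c :: l₁, b, r, by simp [h1], h2, ?_⟩
      intro x hx
      rcases List.mem_cons.1 hx with rfl | hx
      · exact hc
      · exact h3 x hx

theorem step_down {n : ℕ} (σ : Equiv.Perm (Fin n)) (h : nonLtrMaxCount σ ≠ 0) :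
    ∃ γ, RightJump γ σ ∧ nonLtrMaxCount γ < nonLtrMaxCount σ := by
  rw [count_eq] at h
  obtain ⟨a, ha⟩ := Set.nonempty_of_ncard_ne_zero h
  have ha0 := ha
  obtain ⟨y, hay, hb⟩ := ha
  have hnd : (permWord σ).Nodup := List.nodup_ofFn.2 σ.injective
  obtain ⟨l₁, b, r, hw, hab, hl₁⟩ := split_first (fun x => a < x) (permWord σ)
    ⟨y, (bef_mem _ _ _ hb).1, hay⟩
  have hal : a ∉ l₁ := by
    intro hal
    rw [hw] at hb hnd
    rw [bef_append] at hb
    rw [List.nodup_append] at hnd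
    rcases hb with hb | hb | hb
    · exact hl₁ y (bef_mem _ _ _ hb).1 hay
    · exact hl₁ y hb.1 hay
    · exact hnd.2.2 a hal a (bef_mem _ _ _ hb).2 rfl
  have har : a ∈ r := by
    have := (bef_mem _ _ _ hb).2
    rw [hw] at this
    simp only [List.mem_append, List.mem_cons] at this
    rcases this with h | h | h
    · exact absurd h hal
    · exact absurd h hab.ne
    · exact h
  obtain ⟨r₁, r₂, rfl⟩ := List.append_of_mem har
  have hperm : (l₁ ++ a :: ((b :: r₁) ++ r₂)).Perm (permWord σ) := by
    rw [hw]
    refine List.Perm.append_left _ ?_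
    exact (List.perm_middle (l₁ := b :: r₁) (a := a) (l₂ := r₂)).symm
  obtain ⟨γ, hγ⟩ := exists_perm _ σ hperm
  refine ⟨γ, ⟨l₁, b :: r₁, r₂, a, by simp, hγ, by rw [hw]; simp⟩, ?_⟩
  have hnd' := hperm.nodup_iff.2 hnd
  have hal' : a ∉ (b :: r₁) ++ r₂ := by
    rw [List.nodup_append] at hnd'
    exact (List.nodup_cons.1 hnd'.2.1).1
  rw [count_eq, count_eq, hγ]
  apply Set.ncard_lt_ncard _ (Set.toFinite _)
  refine (Set.ssubset_iff_of_subset ?_).2 ⟨a, ha0, ?_⟩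
  · rintro x ⟨z, hxz, hz⟩
    have hxa : x ≠ a := by
      rintro rfl
      rw [bef_append, bef_cons] at hz
      rcases hz with hz | hz | hz | hz
      · exact hal (bef_mem _ _ _ hz).2
      · exact hl₁ z hz.1 hxz
      · exact hal' hz.2
      · exact hal' (bef_mem _ _ _ hz).2
    rw [hw]
    by_cases hza : z = a
    · subst hza
      refine ⟨b, hxz.trans hab, ?_⟩
      have hxb : x ≠ b := (hxz.trans hab).ne
      have h1 : ¬ bef z x l₁ := fun h => hal (bef_mem _ _ _ h).1
      have h2 : ¬ bef z x (b :: r₁ ++ r₂) := fun h => hal' (bef_mem _ _ _ h).1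
      rw [bef_append, bef_cons] at hz
      simp only [List.mem_append, List.mem_cons, List.cons_append] at hz h2
      simp only [bef_append, bef_cons, List.mem_append, List.mem_cons]
      tauto
    · refine ⟨z, hxz, ?_⟩
      simp only [bef_append, bef_cons, List.mem_append, List.mem_cons, List.cons_append] at hz ⊢
      tauto
  · rintro ⟨z, hxz, hz⟩
    rw [bef_append, bef_cons] at hz
    rcases hz with hz | hz | hz | hz
    · exact hal (bef_mem _ _ _ hz).2
    · exact hl₁ z hz.1 hxz
    · exact hal' hz.2
    · exact hal' (bef_mem _ _ _ hz).2

theorem inC_of_le {n : ℕ} : ∀ (p : ℕ) (σ : Equiv.Perm (Fin n)), nonLtrMaxCount σ ≤ p → InC p σ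
  | 0, σ, h => ⟨0, le_rfl, (eq_one_of_count σ (by omega)).symm⟩
  | p + 1, σ, h => by
    by_cases h0 : nonLtrMaxCount σ = 0
    · exact ⟨0, by omega, (eq_one_of_count σ h0).symm⟩
    · obtain ⟨γ, hj, hlt⟩ := step_down σ h0
      obtain ⟨q, hq, hr⟩ := inC_of_le p γ (by omega)
      exact ⟨q + 1, by omega, reach_snoc q hr hj⟩

theorem inC_iff {n : ℕ} (p : ℕ) (σ : Equiv.Perm (Fin n)) : InC p σ ↔ nonLtrMaxCount σ ≤ p := by
  refine ⟨?_, inC_of_le p σ⟩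
  rintro ⟨q, hq, hr⟩
  have := reach_le q hr
  rw [count_one] at this
  omega

theorem nonLtr_subset {m : ℕ} (σ : Equiv.Perm (Fin (m + 1))) :
    {i | ¬ IsLtrMax σ i} ⊆ ({0}ᶜ : Set (Fin (m + 1))) := by
  intro i hi h0
  have h0 : i = 0 := h0
  subst h0
  exact hi (fun j hj => by rw [Fin.le_zero_iff.1 hj])

theorem card_compl_zero (m : ℕ) : ({0}ᶜ : Set (Fin (m + 1))).ncard = m := by
  have := Set.ncard_add_ncard_compl ({0} : Set (Fin (m + 1)))
  simp at this
  omega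

theorem count_le (k : ℕ) (σ : Equiv.Perm (Fin k)) : nonLtrMaxCount σ ≤ k - 1 := by
  cases k with
  | zero =>
    have : σ = 1 := Subsingleton.elim _ _
    rw [this, count_one]
  | succ m =>
    have := Set.ncard_le_ncard (nonLtr_subset σ) (Set.toFinite _)
    rw [card_compl_zero] at this
    exact this

theorem count_eq_iff {m : ℕ} (σ : Equiv.Perm (Fin (m + 1))) :
    nonLtrMaxCount σ = m ↔ σ 0 = Fin.last m := by
  constructor
  · intro h
    have he := Set.eq_of_subset_of_ncard_le (nonLtr_subset σ)
      (by rw [card_compl_zero]; exact h.ge) (Set.toFinite _)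
    by_contra hc
    have h1 : σ.symm (Fin.last m) ∈ ({0}ᶜ : Set (Fin (m + 1))) := by
      intro h2
      have h2 : σ.symm (Fin.last m) = 0 := h2
      apply hc
      rw [← h2]; simp
    rw [← he] at h1
    exact h1 (fun j _ => by simpa using Fin.le_last _)
  · intro h
    have : {i | ¬ IsLtrMax σ i} = ({0}ᶜ : Set (Fin (m + 1))) := by
      refine (nonLtr_subset σ).antisymm ?_
      intro i hi hm
      have h1 := hm 0 (Fin.zero_le _)
      rw [h] at h1
      have h2 := Fin.last_le_iff.1 h1
      exact hi (σ.injective (h2.trans h.symm))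
    rw [nonLtrMaxCount, this, card_compl_zero]

theorem inBasis_iff {m : ℕ} (hm : 1 ≤ m) (σ : Equiv.Perm (Fin (m + 1))) :
    InBasis (m - 1) σ ↔ σ 0 = Fin.last m := by
  rw [← count_eq_iff]
  have hle := count_le _ σ
  constructor
  · rintro ⟨h, -⟩
    rw [inC_iff] at h
    omega
  · intro h
    refine ⟨by rw [inC_iff]; omega, ?_⟩
    rintro k π ⟨f, hf, -⟩ hk
    rw [inC_iff]
    have h1 := count_le k π
    have h2 := Fintype.card_le_of_injective f hf.injective
    simp at h2
    omega

theorem basis_with_max_nonLtrMax (n : ℕ) (hn : 1 < n) :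
    (∀ σ : Equiv.Perm (Fin n),
      ((∃ q : ℕ, InBasis q σ) ∧ nonLtrMaxCount σ = n - 1) ↔
        (σ ⟨0, by omega⟩ : ℕ) = n - 1) ∧
    bnp n (n - 2) = (n - 1).factorial := by
  obtain ⟨m, rfl⟩ : ∃ m, n = m + 1 := ⟨n - 1, by omega⟩
  have hm : 1 ≤ m := by omega
  constructor
  · intro σ
    have key : (σ ⟨0, by omega⟩ : ℕ) = m + 1 - 1 ↔ σ 0 = Fin.last m := by
      rw [Fin.ext_iff]; rfl
    rw [key]
    constructor
    · rintro ⟨-, h⟩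
      exact (count_eq_iff σ).1 h
    · intro h
      exact ⟨⟨_, (inBasis_iff hm σ).2 h⟩, (count_eq_iff σ).2 h⟩
  · show Nat.card {σ : Equiv.Perm (Fin (m + 1)) // InBasis (m - 1) σ} = m.factorial
    have e1 : {σ : Equiv.Perm (Fin (m + 1)) // InBasis (m - 1) σ} ≃ Equiv.Perm (Fin m) :=
      { toFun := fun σ => (Equiv.Perm.decomposeFin σ.1).2
        invFun := fun e => ⟨Equiv.Perm.decomposeFin.symm (Fin.last m, e), by
          rw [inBasis_iff hm]; simp⟩
        left_inv := by
          rintro ⟨σ, hσ⟩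
          rw [inBasis_iff hm] at hσ
          apply Subtype.ext
          show Equiv.Perm.decomposeFin.symm (Fin.last m, (Equiv.Perm.decomposeFin σ).2) = σ
          rw [Equiv.symm_apply_eq]
          refine Prod.ext ?_ rfl
          obtain ⟨⟨p, e⟩, rfl⟩ := Equiv.Perm.decomposeFin.symm.surjective σ
          rw [← hσ]
          simp
        right_inv := by
          intro e
          simp }
    rw [Nat.card_congr e1, Nat.card_eq_fintype_card, Fintype.card_perm, Fintype.card_fin]
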